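/- arXiv:1001.3908 — 3 statements merged into one kernel-verified Lean document; each statement's English description precedes it below -/
import Mathlib

section
/- (Joint AEP for bipartite sequences, part 1.) Let U, U', T, T' be finite alphabets with joint distributions P_{U,U'} on U × U' and P_{T,T'} on T × T'. For n, d ∈ ℕ, N = n + d, let (X^N, Y^N) = ((U^n || T^d), (U'^n || T'^d)) where (U_i, U'_i), i = 1..n, are i.i.d. ∼ P_{U,U'}, (T_j, T'_j), j = 1..d, are i.i.d. ∼ P_{T,T'}, and the two blocks are independent. The set A_ε^{(N,n)} of (ε, n)-bipartite jointly typical pairs consists of all pairs (x^N, y^N) = ((u^n || t^d), (u'^n || t'^d)) such that x^N, y^N are each (ε, n)-bipartite typical with respect to the marginal distribution pairs (P_U, P_T) and (P_{U'}, P_{T'}) respectively, and additionally |−(1/N)·log₂ P(x^N, y^N) − (n·H(U,U') + d·H(T,T'))/N| < ε, where P(x^N, y^N) = ∏_{i=1}^n P_{U,U'}(u_i, u'_i) · ∏_{j=1}^d P_{T,T'}(t_j, t'_j). Then for every ε > 0 there exist n₀, d₀ such that for all n > n₀, d > d₀, Pr((X^N, Y^N) ∈ A_ε^{(N,n)}) ≥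 1 − ε. -/
open scoped BigOperators Classical

noncomputable section

/-- `p` is a probability mass function on a finite alphabet. -/
def IsPMF {α : Type*} [Fintype α] (p : α → ℝ) : Prop :=
  (∀ a, 0 ≤ p a) ∧ ∑ a, p a = 1

/-- Shannon entropy (in bits) of a pmf on a finite alphabet. -/
def pmfEntropy {α : Type*} [Fintype α] (p : α → ℝ) : ℝ :=
  -∑ a, p a * Real.logb 2 (p a)

/-- Probability of an i.i.d. `n`-sequence under the pmf `p`. -/
def seqProb {α : Type*} {n : ℕ} (p : α → ℝ) (x : Fin n → α) : ℝ :=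
  ∏ i, p (x i)

/-- A bipartite sequence `x = (u^n ‖ t^d)` is `(ε, n)`-bipartite typical w.r.t. `(pU, pT)`. -/
def BipTypical {U T : Type*} [Fintype U] [Fintype T]
    (pU : U → ℝ) (pT : T → ℝ) (ε : ℝ) {n d : ℕ}
    (x : (Fin n → U) × (Fin d → T)) : Prop :=
  |(-(1 / ((n : ℝ) + (d : ℝ))) * Real.logb 2 (seqProb pU x.1 * seqProb pT x.2)) -
      (((n : ℝ) * pmfEntropy pU + (d : ℝ) * pmfEntropy pT) / ((n : ℝ) + (d : ℝ)))| < ε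

/-- A pair of bipartite sequences `(x, y)` is `(ε, n)`-bipartite jointly typical w.r.t. the
joint pmfs `pUU` on `U × U'` and `pTT` on `T × T'`: each sequence is bipartite typical with
respect to the corresponding marginals, and the pair satisfies the joint typicality bound. -/
def BipJointTypical {U U' T T' : Type*} [Fintype U] [Fintype U'] [Fintype T] [Fintype T']
    (pUU : U × U' → ℝ) (pTT : T × T' → ℝ) (ε : ℝ) {n d : ℕ}
    (x : (Fin n → U) × (Fin d → T)) (y : (Fin n → U') × (Fin d → T')) : Prop :=
  BipTypical (fun u => ∑ u', pUU (u, u')) (fun t => ∑ t', pTT (t, t')) ε x ∧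
  BipTypical (fun u' => ∑ u, pUU (u, u')) (fun t' => ∑ t, pTT (t, t')) ε y ∧
  |(-(1 / ((n : ℝ) + (d : ℝ))) *
      Real.logb 2 ((∏ i, pUU (x.1 i, y.1 i)) * ∏ j, pTT (x.2 j, y.2 j))) -
      (((n : ℝ) * pmfEntropy pUU + (d : ℝ) * pmfEntropy pTT) / ((n : ℝ) + (d : ℝ)))| < ε

theorem aux_mom {α : Type*} [Fintype α] (p f : α → ℝ) (hp : ∑ a, p a = 1)
    (hf : ∑ a, p a * f a = 0) (n : ℕ) : ∀ c : ℝ,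
    ∑ x : Fin n → α, (∏ i, p (x i)) * (c + ∑ i, f (x i)) ^ 2
      = c ^ 2 + n * ∑ a, p a * f a ^ 2 := by
  induction n with
  | zero => intro c; simp
  | succ n ih =>
    intro c
    rw [← (Fin.consEquiv (fun _ => α)).sum_comp, Fintype.sum_prod_type]
    have h1 : ∀ a : α, ∑ x : Fin n → α,
        (∏ i, p ((Fin.consEquiv (fun _ => α)) (a, x) i)) *
          (c + ∑ i, f ((Fin.consEquiv (fun _ => α)) (a, x) i)) ^ 2
        = p a * c ^ 2 + 2 * c * (p a * f a) + p a * f a ^ 2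
          + p a * (n * ∑ a, p a * f a ^ 2) := by
      intro a
      have h2 := ih (c + f a)
      have h3 : ∀ x : Fin n → α, (∏ i, p ((Fin.consEquiv (fun _ => α)) (a, x) i)) *
          (c + ∑ i, f ((Fin.consEquiv (fun _ => α)) (a, x) i)) ^ 2
          = p a * ((∏ i, p (x i)) * (c + f a + ∑ i, f (x i)) ^ 2) := by
        intro x
        simp only [Fin.consEquiv, Equiv.coe_fn_mk, Fin.prod_univ_succ, Fin.sum_univ_succ,
          Fin.cons_zero, Fin.cons_succ]
        ring
      rw [Finset.sum_congr rfl (fun x _ => h3 x), ← Finset.mul_sum, h2]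
      ring
    rw [Finset.sum_congr rfl (fun a _ => h1 a)]
    simp only [Finset.sum_add_distrib, ← Finset.mul_sum, ← Finset.sum_mul, hp, hf]
    push_cast
    ring

theorem aux_one {α : Type*} [Fintype α] (p : α → ℝ) (hp : ∑ a, p a = 1) (n : ℕ) :
    ∑ x : Fin n → α, (∏ i, p (x i)) = 1 := by
  have := aux_mom p (fun _ => 0) hp (by simp) n 1
  simpa using this

theorem aux_mom2 {α β : Type*} [Fintype α] [Fintype β] (p f : α → ℝ) (q g : β → ℝ)
    (hp : ∑ a, p a = 1) (hf : ∑ a, p a * f a = 0)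
    (hq : ∑ a, q a = 1) (hg : ∑ a, q a * g a = 0) (n d : ℕ) :
    ∑ w : (Fin n → α) × (Fin d → β), ((∏ i, p (w.1 i)) * ∏ j, q (w.2 j)) *
      (∑ i, f (w.1 i) + ∑ j, g (w.2 j)) ^ 2
      = n * (∑ a, p a * f a ^ 2) + d * ∑ b, q b * g b ^ 2 := by
  rw [Fintype.sum_prod_type]
  simp only [mul_assoc, ← Finset.mul_sum]
  simp only [aux_mom q g hq hg d]
  have h0 := aux_mom p f hp hf n 0
  simp only [mul_add, Finset.sum_add_distrib, ← Finset.sum_mul, aux_one p hp n]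
  simp only [zero_add] at h0
  rw [h0]
  ring

theorem aux_pt {n d : ℕ} (a : Fin n → ℝ) (b : Fin d → ℝ) (ha : ∀ i, 0 < a i)
    (hb : ∀ j, 0 < b j) (H K ε : ℝ) (hε : 0 < ε) (hN : 0 < (n : ℝ) + d)
    (h : ¬ |(-(1 / ((n : ℝ) + (d : ℝ))) * Real.logb 2 ((∏ i, a i) * ∏ j, b j)) -
      (((n : ℝ) * H + (d : ℝ) * K) / ((n : ℝ) + (d : ℝ)))| < ε) :
    1 ≤ (∑ i, (Real.logb 2 (a i) + H) + ∑ j, (Real.logb 2 (b j) + K)) ^ 2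
      / (ε ^ 2 * ((n : ℝ) + d) ^ 2) := by
  rw [Real.logb_mul (Finset.prod_pos fun i _ => ha i).ne' (Finset.prod_pos fun i _ => hb i).ne',
    Real.logb_prod _ _ (fun i _ => (ha i).ne'), Real.logb_prod _ _ (fun i _ => (hb i).ne')] at h
  simp only [Finset.sum_add_distrib, Finset.sum_const, Finset.card_univ, Fintype.card_fin,
    nsmul_eq_mul]
  set A := ∑ i, Real.logb 2 (a i)
  set B := ∑ i, Real.logb 2 (b i)
  have e : (-(1 / ((n : ℝ) + (d : ℝ))) * (A + B)) -
      (((n : ℝ) * H + (d : ℝ) * K) / ((n : ℝ) + (d : ℝ)))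
      = -((A + n * H + (B + d * K)) / ((n : ℝ) + d)) := by
    field_simp
    ring
  rw [e, abs_neg, not_lt] at h
  rw [le_div_iff₀ (by positivity), one_mul]
  have h2 := pow_le_pow_left₀ hε.le h 2
  rw [sq_abs, div_pow, le_div_iff₀ (by positivity)] at h2
  exact h2

theorem aux_center {α : Type*} [Fintype α] (p : α → ℝ) (hp : ∑ a, p a = 1) :
    ∑ a, p a * (Real.logb 2 (p a) + pmfEntropy p) = 0 := by
  simp only [mul_add, Finset.sum_add_distrib, ← Finset.sum_mul, hp, pmfEntropy]
  ring

theorem aux_center1 {α β : Type*} [Fintype α] [Fintype β] (p : α × β → ℝ)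
    (hp : ∑ a, p a = 1) :
    ∑ a, p a * (Real.logb 2 (∑ b, p (a.1, b)) + pmfEntropy fun a => ∑ b, p (a, b)) = 0 := by
  have h := aux_center (fun a => ∑ b, p (a, b)) (by rw [← Fintype.sum_prod_type]; exact hp)
  rw [Fintype.sum_prod_type]
  simpa only [← Finset.sum_mul] using h

theorem aux_center2 {α β : Type*} [Fintype α] [Fintype β] (p : α × β → ℝ)
    (hp : ∑ a, p a = 1) :
    ∑ a, p a * (Real.logb 2 (∑ c, p (c, a.2)) + pmfEntropy fun b => ∑ c, p (c, b)) = 0 := by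
  have h := aux_center (fun b => ∑ a, p (a, b)) (by rw [← Fintype.sum_prod_type_right]; exact hp)
  rw [Fintype.sum_prod_type_right]
  simpa only [← Finset.sum_mul] using h

def auxEquiv (U U' T T' : Type*) (n d : ℕ) :
    (Fin n → U × U') × (Fin d → T × T') ≃
      ((Fin n → U) × (Fin d → T)) × ((Fin n → U') × (Fin d → T')) where
  toFun w := ((fun i => (w.1 i).1, fun j => (w.2 j).1), (fun i => (w.1 i).2, fun j => (w.2 j).2))
  invFun p := (fun i => (p.1.1 i, p.2.1 i), fun j => (p.1.2 j, p.2.2 j))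
  left_inv _ := rfl
  right_inv _ := rfl

set_option maxHeartbeats 1000000 in
/-- Joint AEP for bipartite sequences, part 1: for every `ε > 0`, for all sufficiently
large `n` and `d`, a pair of bipartite random sequences drawn i.i.d. from the joint
distributions lies in the jointly typical set with probability at least `1 - ε`. -/
theorem bipartite_joint_AEP_part1 {U U' T T' : Type*}
    [Fintype U] [Fintype U'] [Fintype T] [Fintype T']
    (pUU : U × U' → ℝ) (pTT : T × T' → ℝ) (hUU : IsPMF pUU) (hTT : IsPMF pTT) :
    ∀ ε > (0 : ℝ), ∃ n₀ d₀ : ℕ, ∀ n d : ℕ, n > n₀ → d > d₀ →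
      (1 : ℝ) - ε ≤
        ∑ p ∈ Finset.univ.filter
            (fun p : ((Fin n → U) × (Fin d → T)) × ((Fin n → U') × (Fin d → T')) =>
              BipJointTypical pUU pTT ε p.1 p.2),
          (∏ i, pUU (p.1.1 i, p.2.1 i)) * ∏ j, pTT (p.1.2 j, p.2.2 j) := by
  intro ε hε
  obtain ⟨hU0, hU1⟩ := hUU
  obtain ⟨hT0, hT1⟩ := hTT
  set f1 : U × U' → ℝ := fun a =>
    Real.logb 2 (∑ b, pUU (a.1, b)) + pmfEntropy (fun a => ∑ b, pUU (a, b)) with hf1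
  set f2 : U × U' → ℝ := fun a =>
    Real.logb 2 (∑ c, pUU (c, a.2)) + pmfEntropy (fun b => ∑ c, pUU (c, b)) with hf2
  set f3 : U × U' → ℝ := fun a => Real.logb 2 (pUU a) + pmfEntropy pUU with hf3
  set g1 : T × T' → ℝ := fun a =>
    Real.logb 2 (∑ b, pTT (a.1, b)) + pmfEntropy (fun a => ∑ b, pTT (a, b)) with hg1
  set g2 : T × T' → ℝ := fun a =>
    Real.logb 2 (∑ c, pTT (c, a.2)) + pmfEntropy (fun b => ∑ c, pTT (c, b)) with hg2
  set g3 : T × T' → ℝ := fun a => Real.logb 2 (pTT a) + pmfEntropy pTT with hg3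
  have cf1 : ∑ a, pUU a * f1 a = 0 := aux_center1 pUU hU1
  have cf2 : ∑ a, pUU a * f2 a = 0 := aux_center2 pUU hU1
  have cf3 : ∑ a, pUU a * f3 a = 0 := aux_center pUU hU1
  have cg1 : ∑ a, pTT a * g1 a = 0 := aux_center1 pTT hT1
  have cg2 : ∑ a, pTT a * g2 a = 0 := aux_center2 pTT hT1
  have cg3 : ∑ a, pTT a * g3 a = 0 := aux_center pTT hT1
  have vnn : ∀ f : U × U' → ℝ, 0 ≤ ∑ a, pUU a * f a ^ 2 := fun f =>
    Finset.sum_nonneg fun a _ => mul_nonneg (hU0 a) (sq_nonneg _)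
  have wnn : ∀ f : T × T' → ℝ, 0 ≤ ∑ a, pTT a * f a ^ 2 := fun f =>
    Finset.sum_nonneg fun a _ => mul_nonneg (hT0 a) (sq_nonneg _)
  set V : ℝ := (∑ a, pUU a * f1 a ^ 2) + (∑ a, pUU a * f2 a ^ 2) + ∑ a, pUU a * f3 a ^ 2 with hV
  set W : ℝ := (∑ a, pTT a * g1 a ^ 2) + (∑ a, pTT a * g2 a ^ 2) + ∑ a, pTT a * g3 a ^ 2 with hW
  have hV0 : 0 ≤ V := by have := vnn f1; have := vnn f2; have := vnn f3; positivity
  have hW0 : 0 ≤ W := by have := wnn g1; have := wnn g2; have := wnn g3; positivity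
  obtain ⟨M, hM⟩ := exists_nat_gt ((V + W) / ε ^ 3)
  refine ⟨M, 0, fun n d hn hd => ?_⟩
  have hnM : (M : ℝ) < n := by exact_mod_cast hn
  have hd0 : (0 : ℝ) < d := by exact_mod_cast hd
  have hM0 : (0 : ℝ) ≤ M := Nat.cast_nonneg M
  have hn0 : (0 : ℝ) < n := by linarith
  have hN : 0 < (n : ℝ) + d := by linarith
  rw [Finset.sum_filter, ← (auxEquiv U U' T T' n d).sum_comp]
  simp only [auxEquiv, Equiv.coe_fn_mk, Prod.mk.eta]
  set P : (Fin n → U × U') × (Fin d → T × T') → ℝ :=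
    fun w => (∏ i, pUU (w.1 i)) * ∏ j, pTT (w.2 j) with hP
  set E : ℝ := ε ^ 2 * ((n : ℝ) + d) ^ 2 with hE
  have hE0 : 0 < E := by positivity
  have m1 := aux_mom2 pUU f1 pTT g1 hU1 cf1 hT1 cg1 n d
  have m2 := aux_mom2 pUU f2 pTT g2 hU1 cf2 hT1 cg2 n d
  have m3 := aux_mom2 pUU f3 pTT g3 hU1 cf3 hT1 cg3 n d
  have htot : ∑ w, P w = 1 := by
    rw [hP, Fintype.sum_prod_type]
    simp only [← Finset.mul_sum, aux_one pTT hT1 d, mul_one, aux_one pUU hU1 n]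
  have key : ∀ w : (Fin n → U × U') × (Fin d → T × T'),
      P w - (P w * (∑ i, f1 (w.1 i) + ∑ j, g1 (w.2 j)) ^ 2
        + P w * (∑ i, f2 (w.1 i) + ∑ j, g2 (w.2 j)) ^ 2
        + P w * (∑ i, f3 (w.1 i) + ∑ j, g3 (w.2 j)) ^ 2) / E
      ≤ if BipJointTypical pUU pTT ε (fun i => (w.1 i).1, fun j => (w.2 j).1)
          (fun i => (w.1 i).2, fun j => (w.2 j).2) then P w else 0 := by
    intro w
    have hPw : 0 ≤ P w := mul_nonneg (Finset.prod_nonneg fun i _ => hU0 _)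
      (Finset.prod_nonneg fun i _ => hT0 _)
    set D1 := (∑ i, f1 (w.1 i) + ∑ j, g1 (w.2 j)) with hD1
    set D2 := (∑ i, f2 (w.1 i) + ∑ j, g2 (w.2 j)) with hD2
    set D3 := (∑ i, f3 (w.1 i) + ∑ j, g3 (w.2 j)) with hD3
    have r : (P w * D1 ^ 2 + P w * D2 ^ 2 + P w * D3 ^ 2) / E
      = P w * (D1 ^ 2 / E + D2 ^ 2 / E + D3 ^ 2 / E) := by ring
    rw [r]
    have q1 : 0 ≤ D1 ^ 2 / E := by positivity
    have q2 : 0 ≤ D2 ^ 2 / E := by positivity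
    have q3 : 0 ≤ D3 ^ 2 / E := by positivity
    split_ifs with ht
    · have := mul_nonneg hPw (add_nonneg (add_nonneg q1 q2) q3)
      linarith
    · rcases hPw.eq_or_lt with h0 | hpos
      · rw [← h0]; simp
      · have hne : P w ≠ 0 := hpos.ne'
        have hu : ∀ i, 0 < pUU (w.1 i) := fun i => lt_of_le_of_ne (hU0 _)
          (Ne.symm (Finset.prod_ne_zero_iff.1 (left_ne_zero_of_mul hne) i (Finset.mem_univ i)))
        have hv : ∀ j, 0 < pTT (w.2 j) := fun j => lt_of_le_of_ne (hT0 _)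
          (Ne.symm (Finset.prod_ne_zero_iff.1 (right_ne_zero_of_mul hne) j (Finset.mem_univ j)))
        have hu1 : ∀ i, 0 < ∑ b, pUU ((w.1 i).1, b) := fun i => (hu i).trans_le
          (Finset.single_le_sum (f := fun b => pUU ((w.1 i).1, b)) (fun b _ => hU0 _)
            (Finset.mem_univ (w.1 i).2))
        have hu2 : ∀ i, 0 < ∑ c, pUU (c, (w.1 i).2) := fun i => (hu i).trans_le
          (Finset.single_le_sum (f := fun c => pUU (c, (w.1 i).2)) (fun b _ => hU0 _)
            (Finset.mem_univ (w.1 i).1))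
        have hv1 : ∀ i, 0 < ∑ b, pTT ((w.2 i).1, b) := fun i => (hv i).trans_le
          (Finset.single_le_sum (f := fun b => pTT ((w.2 i).1, b)) (fun b _ => hT0 _)
            (Finset.mem_univ (w.2 i).2))
        have hv2 : ∀ i, 0 < ∑ c, pTT (c, (w.2 i).2) := fun i => (hv i).trans_le
          (Finset.single_le_sum (f := fun c => pTT (c, (w.2 i).2)) (fun b _ => hT0 _)
            (Finset.mem_univ (w.2 i).1))
        have hge : 1 ≤ D1 ^ 2 / E + D2 ^ 2 / E + D3 ^ 2 / E := by
          by_contra hlt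
          apply ht
          refine ⟨?_, ?_, ?_⟩
          · by_contra hc
            have : 1 ≤ D1 ^ 2 / E := aux_pt _ _ hu1 hv1 _ _ ε hε hN hc
            linarith
          · by_contra hc
            have : 1 ≤ D2 ^ 2 / E := aux_pt _ _ hu2 hv2 _ _ ε hε hN hc
            linarith
          · by_contra hc
            have : 1 ≤ D3 ^ 2 / E := aux_pt _ _ hu hv _ _ ε hε hN hc
            linarith
        have := mul_le_mul_of_nonneg_left hge hPw
        linarith
  refine le_trans ?_ (Finset.sum_le_sum fun w _ => key w)
  rw [Finset.sum_sub_distrib, ← Finset.sum_div, Finset.sum_add_distrib, Finset.sum_add_distrib,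
    htot, m1, m2, m3]
  have hb : ((n : ℝ) * V + d * W) / E ≤ ε := by
    rw [div_le_iff₀ hE0]
    rw [div_lt_iff₀ (by positivity)] at hM
    have h1 : (n : ℝ) * V + d * W ≤ (n + d) * (V + W) := by
      have := mul_nonneg hn0.le hW0
      have := mul_nonneg hd0.le hV0
      linarith [add_mul (n : ℝ) d (V + W), mul_add (n : ℝ) V W, mul_add (d : ℝ) V W]
    have h2 : V + W ≤ (n + d) * ε ^ 3 := by
      have : (M : ℝ) * ε ^ 3 ≤ (n + d) * ε ^ 3 := by
        apply mul_le_mul_of_nonneg_right _ (by positivity); linarith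
      linarith
    calc (n : ℝ) * V + d * W ≤ (n + d) * (V + W) := h1
      _ ≤ (n + d) * ((n + d) * ε ^ 3) := mul_le_mul_of_nonneg_left h2 hN.le
      _ = ε * E := by rw [hE]; ring
  have : (n : ℝ) * V + d * W = (↑n * ∑ a, pUU a * f1 a ^ 2 + ↑d * ∑ b, pTT b * g1 b ^ 2)
      + (↑n * ∑ a, pUU a * f2 a ^ 2 + ↑d * ∑ b, pTT b * g2 b ^ 2)
      + (↑n * ∑ a, pUU a * f3 a ^ 2 + ↑d * ∑ b, pTT b * g3 b ^ 2) := by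
    rw [hV, hW]; ring
  rw [← this]
  linarith
end
end

section
/- (Joint AEP for bipartite sequences, part 3, upper bound.) Let P_{U,U'} and P_{T,T'} be joint distributions on finite alphabets U × U' and T × T', and let A_ε^{(N,n)} be the set of (ε, n)-bipartite jointly typical pairs, N = n + d. Let (X̃^N, Ỹ^N) be a pair of independent bipartite random sequences, where X̃^N = (Ũ^n || T̃^d) has i.i.d. parts drawn from the marginals P_U and P_T, Ỹ^N = (Ũ'^n || T̃'^d) has i.i.d. parts drawn from the marginals P_{U'} and P_{T'}, and X̃^N is independent of Ỹ^N. Then Pr((X̃^N, Ỹ^N) ∈ A_ε^{(N,n)}) ≤ 2^{−n·I(U;U') − d·I(T;T') + 3N·ε}, where I denotes mutual information in bits. -/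
open scoped BigOperators Classical

noncomputable section

/-- Mutual information (in bits) of a joint pmf on a product of finite alphabets. -/
def pmfMutualInfo {α β : Type*} [Fintype α] [Fintype β] (p : α × β → ℝ) : ℝ :=
  pmfEntropy (fun a => ∑ b, p (a, b)) + pmfEntropy (fun b => ∑ a, p (a, b)) - pmfEntropy p

lemma aux_ent_fst {α β : Type*} [Fintype α] [Fintype β] (p : α × β → ℝ) (h : ∀ a, 0 ≤ p a) :
    pmfEntropy (fun a => ∑ b, p (a, b)) ≤ pmfEntropy p := by
  unfold pmfEntropy
  rw [neg_le_neg_iff, Fintype.sum_prod_type]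
  refine Finset.sum_le_sum fun a _ => ?_
  rw [Finset.sum_mul]
  refine Finset.sum_le_sum fun b _ => ?_
  rcases (h (a, b)).eq_or_lt with h0 | h0
  · rw [← h0]; simp
  · refine mul_le_mul_of_nonneg_left ?_ h0.le
    refine Real.logb_le_logb_of_le (by norm_num) h0 ?_
    exact Finset.single_le_sum (f := fun b => p (a, b)) (fun b _ => h (a, b)) (Finset.mem_univ b)

lemma aux_ent_snd {α β : Type*} [Fintype α] [Fintype β] (p : α × β → ℝ) (h : ∀ a, 0 ≤ p a) :
    pmfEntropy (fun b => ∑ a, p (a, b)) ≤ pmfEntropy p := by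
  have := aux_ent_fst (fun q : β × α => p (q.2, q.1)) (fun a => h _)
  refine this.trans (le_of_eq ?_)
  unfold pmfEntropy
  congr 1
  exact Fintype.sum_equiv (Equiv.prodComm β α) _ _ (fun x => rfl)

lemma aux_seq_sum {α : Type*} [Fintype α] (p : α → ℝ) (h : ∑ a, p a = 1) (n : ℕ) :
    ∑ x : Fin n → α, seqProb p x = 1 := by
  unfold seqProb
  rw [← Fintype.sum_pow, h, one_pow]

lemma aux_bip_sum {α β : Type*} [Fintype α] [Fintype β] (p : α → ℝ) (q : β → ℝ)
    (h : ∑ a, p a = 1) (h' : ∑ a, q a = 1) (n d : ℕ) :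
    ∑ x : (Fin n → α) × (Fin d → β), seqProb p x.1 * seqProb q x.2 = 1 := by
  rw [Fintype.sum_prod_type, ← Fintype.sum_mul_sum, aux_seq_sum p h, aux_seq_sum q h', one_mul]

lemma aux_joint_sum {U U' T T' : Type*}
    [Fintype U] [Fintype U'] [Fintype T] [Fintype T']
    (pUU : U × U' → ℝ) (pTT : T × T' → ℝ) (hU : ∑ a, pUU a = 1) (hT : ∑ a, pTT a = 1)
    (n d : ℕ) :
    ∑ p : ((Fin n → U) × (Fin d → T)) × ((Fin n → U') × (Fin d → T')),
      ((∏ i, pUU (p.1.1 i, p.2.1 i)) * ∏ j, pTT (p.1.2 j, p.2.2 j)) = 1 := by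
  rw [← aux_bip_sum pUU pTT hU hT n d]
  refine Fintype.sum_equiv ((Equiv.prodProdProdComm _ _ _ _).trans
    (Equiv.prodCongr (Equiv.arrowProdEquivProdArrow (Fin n) (fun _ => U) (fun _ => U')).symm
      (Equiv.arrowProdEquivProdArrow (Fin d) (fun _ => T) (fun _ => T')).symm)) _ _ (fun x => rfl)

lemma aux_upper {N H P ε : ℝ} (hN : 0 < N) (hP : 0 < P)
    (h : |(-(1 / N) * Real.logb 2 P) - H / N| < ε) :
    P ≤ 2 ^ (-H + N * ε) ∧ 2 ^ (-H - N * ε) ≤ P := by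
  have e : (-(1 / N) * Real.logb 2 P) - H / N = (-Real.logb 2 P - H) / N := by ring
  rw [e, abs_lt, lt_div_iff₀ hN, div_lt_iff₀ hN] at h
  constructor
  · rw [← Real.logb_le_iff_le_rpow (by norm_num) hP]; linarith [h.1]
  · rw [← Real.le_logb_iff_rpow_le (by norm_num) hP]; linarith [h.2]

lemma aux_nn {α : Type*} {m : ℕ} {p : α → ℝ} (h : ∀ a, 0 ≤ p a) (x : Fin m → α) :
    0 ≤ seqProb p x := Finset.prod_nonneg fun i _ => h _

/-- Joint AEP for bipartite sequences, part 3 (upper bound): if `X̃` and `Ỹ` are independent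
bipartite random sequences drawn i.i.d. from the marginal distributions, then
`Pr((X̃, Ỹ) ∈ A_ε^{(N,n)}) ≤ 2^{−n·I(U;U') − d·I(T;T') + 3N·ε}`. -/
theorem bipartite_joint_AEP_part3_upper {U U' T T' : Type*}
    [Fintype U] [Fintype U'] [Fintype T] [Fintype T']
    (pUU : U × U' → ℝ) (pTT : T × T' → ℝ) (hUU : IsPMF pUU) (hTT : IsPMF pTT)
    (ε : ℝ) (n d : ℕ) :
    ∑ p ∈ Finset.univ.filter
        (fun p : ((Fin n → U) × (Fin d → T)) × ((Fin n → U') × (Fin d → T')) =>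
          BipJointTypical pUU pTT ε p.1 p.2),
      (seqProb (fun u => ∑ u', pUU (u, u')) p.1.1 * seqProb (fun t => ∑ t', pTT (t, t')) p.1.2) *
        (seqProb (fun u' => ∑ u, pUU (u, u')) p.2.1 *
          seqProb (fun t' => ∑ t, pTT (t, t')) p.2.2) ≤
      (2 : ℝ) ^ (-((n : ℝ) * pmfMutualInfo pUU) - (d : ℝ) * pmfMutualInfo pTT +
        3 * ((n : ℝ) + (d : ℝ)) * ε) := by
  obtain ⟨hU0, hU1⟩ := hUU
  obtain ⟨hT0, hT1⟩ := hTT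
  have mU : ∀ u, 0 ≤ ∑ u', pUU (u, u') := fun u => Finset.sum_nonneg fun _ _ => hU0 _
  have mU' : ∀ u', 0 ≤ ∑ u, pUU (u, u') := fun u => Finset.sum_nonneg fun _ _ => hU0 _
  have mT : ∀ u, 0 ≤ ∑ u', pTT (u, u') := fun u => Finset.sum_nonneg fun _ _ => hT0 _
  have mT' : ∀ u', 0 ≤ ∑ u, pTT (u, u') := fun u => Finset.sum_nonneg fun _ _ => hT0 _
  have sU : ∑ u, ∑ u', pUU (u, u') = 1 := by rw [← hU1, Fintype.sum_prod_type]
  have sU' : ∑ u', ∑ u, pUU (u, u') = 1 := by rw [← hU1, Fintype.sum_prod_type_right]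
  have sT : ∑ u, ∑ u', pTT (u, u') = 1 := by rw [← hT1, Fintype.sum_prod_type]
  have sT' : ∑ u', ∑ u, pTT (u, u') = 1 := by rw [← hT1, Fintype.sum_prod_type_right]
  have hn : (0:ℝ) ≤ n := Nat.cast_nonneg n
  have hd : (0:ℝ) ≤ d := Nat.cast_nonneg d
  have e1 := mul_le_mul_of_nonneg_left (aux_ent_fst pUU hU0) hn
  have e2 := mul_le_mul_of_nonneg_left (aux_ent_snd pUU hU0) hn
  have e3 := mul_le_mul_of_nonneg_left (aux_ent_fst pTT hT0) hd
  have e4 := mul_le_mul_of_nonneg_left (aux_ent_snd pTT hT0) hd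
  by_cases hc : (∃ p : ((Fin n → U) × (Fin d → T)) × ((Fin n → U') × (Fin d → T')),
      BipJointTypical pUU pTT ε p.1 p.2 ∧
        ((∏ i, pUU (p.1.1 i, p.2.1 i)) * ∏ j, pTT (p.1.2 j, p.2.2 j)) = 0) ∨
      (n : ℝ) + d = 0
  · have hR : (1:ℝ) ≤ (2 : ℝ) ^ (-((n : ℝ) * pmfMutualInfo pUU) - (d : ℝ) * pmfMutualInfo pTT +
        3 * ((n : ℝ) + (d : ℝ)) * ε) := by
      refine Real.one_le_rpow (by norm_num) ?_
      by_cases hN : (n : ℝ) + d = 0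
      · have h1 : (n : ℝ) = 0 := by linarith
        have h2 : (d : ℝ) = 0 := by linarith
        rw [h1, h2]; simp
      · have hN' : 0 < (n : ℝ) + d := lt_of_le_of_ne (by linarith) (Ne.symm hN)
        rcases hc with ⟨p, hp, hz⟩ | hc
        · have h3 := hp.2.2
          have hε : 0 < ε := lt_of_le_of_lt (abs_nonneg _) h3
          rw [hz, Real.logb_zero, mul_zero, zero_sub, abs_neg] at h3
          have h4 := (le_abs_self _).trans_lt h3
          rw [div_lt_iff₀ hN'] at h4
          have := mul_pos hN' hε
          unfold pmfMutualInfo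
          nlinarith
        · exact absurd hc hN
    refine le_trans ?_ hR
    refine (Finset.sum_le_univ_sum_of_nonneg fun p => ?_).trans ?_
    · exact mul_nonneg (mul_nonneg (aux_nn mU _) (aux_nn mT _)) (mul_nonneg (aux_nn mU' _) (aux_nn mT' _))
    · refine le_of_eq ?_
      rw [Fintype.sum_prod_type]
      have := Fintype.sum_mul_sum
        (fun x : (Fin n → U) × (Fin d → T) =>
          seqProb (fun u => ∑ u', pUU (u, u')) x.1 * seqProb (fun t => ∑ t', pTT (t, t')) x.2)
        (fun y : (Fin n → U') × (Fin d → T') => seqProb (fun u' => ∑ u, pUU (u, u')) y.1 *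
          seqProb (fun t' => ∑ t, pTT (t, t')) y.2)
      rw [← this, aux_bip_sum _ _ sU sT, aux_bip_sum _ _ sU' sT', one_mul]
  · push Not at hc
    obtain ⟨hc, hN⟩ := hc
    have hN' : 0 < (n : ℝ) + d := lt_of_le_of_ne (by linarith) (Ne.symm hN)
    set R := (2 : ℝ) ^ (-((n : ℝ) * pmfMutualInfo pUU) - (d : ℝ) * pmfMutualInfo pTT +
        3 * ((n : ℝ) + (d : ℝ)) * ε) with hRdef
    have hR0 : 0 < R := Real.rpow_pos_of_pos (by norm_num) _
    have key : ∀ p ∈ Finset.univ.filter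
        (fun p : ((Fin n → U) × (Fin d → T)) × ((Fin n → U') × (Fin d → T')) =>
          BipJointTypical pUU pTT ε p.1 p.2),
      (seqProb (fun u => ∑ u', pUU (u, u')) p.1.1 * seqProb (fun t => ∑ t', pTT (t, t')) p.1.2) *
        (seqProb (fun u' => ∑ u, pUU (u, u')) p.2.1 *
          seqProb (fun t' => ∑ t, pTT (t, t')) p.2.2) ≤
        R * ((∏ i, pUU (p.1.1 i, p.2.1 i)) * ∏ j, pTT (p.1.2 j, p.2.2 j)) := by
      intro p hp
      have hp := (Finset.mem_filter.1 hp).2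
      have jnn : 0 ≤ (∏ i, pUU (p.1.1 i, p.2.1 i)) * ∏ j, pTT (p.1.2 j, p.2.2 j) :=
        mul_nonneg (Finset.prod_nonneg fun i _ => hU0 _) (Finset.prod_nonneg fun i _ => hT0 _)
      have jpos := lt_of_le_of_ne jnn (Ne.symm (hc p hp))
      have xnn := mul_nonneg (aux_nn mU p.1.1) (aux_nn mT p.1.2)
      have ynn := mul_nonneg (aux_nn mU' p.2.1) (aux_nn mT' p.2.2)
      rcases xnn.eq_or_lt with h0 | xpos
      · rw [← h0, zero_mul]; positivity
      rcases ynn.eq_or_lt with h0 | ypos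
      · rw [← h0, mul_zero]; positivity
      have hx := (aux_upper hN' xpos hp.1).1
      have hy := (aux_upper hN' ypos hp.2.1).1
      have hj := (aux_upper hN' jpos hp.2.2).2
      refine (mul_le_mul hx hy ypos.le (by positivity)).trans ?_
      refine le_trans (le_of_eq ?_) (mul_le_mul_of_nonneg_left hj hR0.le)
      rw [hRdef, ← Real.rpow_add (by norm_num), ← Real.rpow_add (by norm_num)]
      congr 1
      unfold pmfMutualInfo
      ring
    refine (Finset.sum_le_sum key).trans ?_
    rw [← Finset.mul_sum]
    refine mul_le_of_le_one_right hR0.le ?_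
    rw [← aux_joint_sum pUU pTT hU1 hT1 n d]
    refine Finset.sum_le_univ_sum_of_nonneg fun p => ?_
    exact mul_nonneg (Finset.prod_nonneg fun i _ => hU0 _) (Finset.prod_nonneg fun i _ => hT0 _)
end
end

section
/- (Degraded broadcast channel bound.) Let X_O, X_R, Y_O, Y_R, Z_O, Z_R be discrete random variables with finite ranges on a common probability space, and set X = (X_O, X_R), Y = (Y_O, Y_R), Z = (Z_O, Z_R). Assume the degraded-channel Markov chain Z_O ↔ Y_O ↔ X_O ↔ X_R ↔ Z_R ↔ Y_R, i.e., the six variables form a Markov chain in this order (each variable is conditionally independent of all earlier ones given its immediate predecessor). Then the conditional mutual information satisfies I(X; Y | Z) ≤ I(X_O; Y_O | Z_O). -/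
open scoped BigOperators Classical

noncomputable section

/-- `μ` is a probability mass function on the finite sample space `Ω`. -/
def IsProb {Ω : Type*} [Fintype Ω] (μ : Ω → ℝ) : Prop :=
  (∀ ω, 0 ≤ μ ω) ∧ ∑ ω, μ ω = 1

/-- The probability that the discrete random variable `X` takes the value `a`. -/
def pr {Ω : Type*} [Fintype Ω] (μ : Ω → ℝ) {α : Type*} (X : Ω → α) (a : α) : ℝ :=
  ∑ ω ∈ Finset.univ.filter (fun ω => X ω = a), μ ω

/-- Shannon entropy (in bits) of a discrete random variable with finite range. -/
def H {Ω : Type*} [Fintype Ω] (μ : Ω → ℝ) {α : Type*} [Fintype α] (X : Ω → α) : ℝ :=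
  -∑ a : α, pr μ X a * Real.logb 2 (pr μ X a)

/-- Conditional entropy `H(X | Y) = H(X, Y) − H(Y)` (in bits). -/
def condH {Ω : Type*} [Fintype Ω] (μ : Ω → ℝ) {α β : Type*} [Fintype α] [Fintype β]
    (X : Ω → α) (Y : Ω → β) : ℝ :=
  H μ (fun ω => (X ω, Y ω)) - H μ Y

/-- Mutual information `I(X; Y) = H(X) + H(Y) − H(X, Y)` (in bits). -/
def MI {Ω : Type*} [Fintype Ω] (μ : Ω → ℝ) {α β : Type*} [Fintype α] [Fintype β]
    (X : Ω → α) (Y : Ω → β) : ℝ :=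
  H μ X + H μ Y - H μ (fun ω => (X ω, Y ω))

/-- Conditional mutual information
`I(X; Y | Z) = H(X, Z) + H(Y, Z) − H(X, Y, Z) − H(Z)` (in bits). -/
def CMI {Ω : Type*} [Fintype Ω] (μ : Ω → ℝ) {α β γ : Type*} [Fintype α] [Fintype β] [Fintype γ]
    (X : Ω → α) (Y : Ω → β) (Z : Ω → γ) : ℝ :=
  H μ (fun ω => (X ω, Z ω)) + H μ (fun ω => (Y ω, Z ω)) -
    H μ (fun ω => (X ω, Y ω, Z ω)) - H μ Z

/-- `X` and `Y` are conditionally independent given `Z`: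
`P(X = a, Y = b, Z = c) · P(Z = c) = P(X = a, Z = c) · P(Y = b, Z = c)` for all `a, b, c`. -/
def CondIndep {Ω : Type*} [Fintype Ω] (μ : Ω → ℝ) {α β γ : Type*}
    (X : Ω → α) (Y : Ω → β) (Z : Ω → γ) : Prop :=
  ∀ a b c, pr μ (fun ω => (X ω, Y ω, Z ω)) (a, b, c) * pr μ Z c =
    pr μ (fun ω => (X ω, Z ω)) (a, c) * pr μ (fun ω => (Y ω, Z ω)) (b, c)

/-- `X` and `Y` are independent: `P(X = a, Y = b) = P(X = a) · P(Y = b)` for all `a, b`. -/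
def Indep {Ω : Type*} [Fintype Ω] (μ : Ω → ℝ) {α β : Type*}
    (X : Ω → α) (Y : Ω → β) : Prop :=
  ∀ a b, pr μ (fun ω => (X ω, Y ω)) (a, b) = pr μ X a * pr μ Y b

theorem sum_pr_mul {Ω : Type*} [Fintype Ω] (μ : Ω → ℝ) {α : Type*} [Fintype α] (X : Ω → α)
    (g : α → ℝ) : ∑ a, pr μ X a * g a = ∑ ω, μ ω * g (X ω) := by
  rw [← Finset.sum_fiberwise Finset.univ X]
  refine Finset.sum_congr rfl fun a _ => ?_
  unfold pr
  rw [Finset.sum_mul]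
  refine Finset.sum_congr (by ext; simp) fun ω h => ?_
  rw [(Finset.mem_filter.1 h).2]

theorem H_eq {Ω : Type*} [Fintype Ω] (μ : Ω → ℝ) {α : Type*} [Fintype α] (X : Ω → α) :
    H μ X = -∑ ω, μ ω * Real.logb 2 (pr μ X (X ω)) := by
  unfold H
  rw [sum_pr_mul μ X (fun a => Real.logb 2 (pr μ X a))]

theorem H_congr {Ω : Type*} [Fintype Ω] (μ : Ω → ℝ) {α β : Type*} [Fintype α] [Fintype β]
    (X : Ω → α) (Y : Ω → β) (h : ∀ ω ω', X ω' = X ω ↔ Y ω' = Y ω) : H μ X = H μ Y := by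
  rw [H_eq, H_eq]
  congr 1
  refine Finset.sum_congr rfl fun ω _ => ?_
  have : pr μ X (X ω) = pr μ Y (Y ω) := by
    unfold pr
    exact Finset.sum_congr (by ext ω'; simp [h ω ω']) fun _ _ => rfl
  rw [this]

theorem pr_nonneg {Ω : Type*} [Fintype Ω] {μ : Ω → ℝ} (hμ : IsProb μ) {α : Type*} (X : Ω → α)
    (a : α) : 0 ≤ pr μ X a := Finset.sum_nonneg fun ω _ => hμ.1 ω

theorem pr_pos {Ω : Type*} [Fintype Ω] {μ : Ω → ℝ} (hμ : IsProb μ) {α : Type*} (X : Ω → α)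
    (ω : Ω) (h : 0 < μ ω) : 0 < pr μ X (X ω) :=
  lt_of_lt_of_le h (Finset.single_le_sum (f := μ) (fun ω _ => hμ.1 ω) (by simp))

theorem pr_marg {Ω : Type*} [Fintype Ω] (μ : Ω → ℝ) {α γ : Type*} [Fintype α]
    (X : Ω → α) (Z : Ω → γ) (c : γ) : ∑ a, pr μ (fun ω => (X ω, Z ω)) (a, c) = pr μ Z c := by
  unfold pr
  rw [← Finset.sum_fiberwise (Finset.univ.filter fun ω => Z ω = c) X]
  refine Finset.sum_congr rfl fun a _ => Finset.sum_congr ?_ fun _ _ => rfl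
  ext ω
  simp [and_comm]

theorem CMI_eq {Ω : Type*} [Fintype Ω] (μ : Ω → ℝ)
    {α β γ : Type*} [Fintype α] [Fintype β] [Fintype γ]
    (X : Ω → α) (Y : Ω → β) (Z : Ω → γ) :
    CMI μ X Y Z = ∑ ω, μ ω * (Real.logb 2 (pr μ (fun ω => (X ω, Y ω, Z ω)) (X ω, Y ω, Z ω))
      + Real.logb 2 (pr μ Z (Z ω)) - Real.logb 2 (pr μ (fun ω => (X ω, Z ω)) (X ω, Z ω))
      - Real.logb 2 (pr μ (fun ω => (Y ω, Z ω)) (Y ω, Z ω))) := by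
  unfold CMI
  simp only [H_eq, mul_add, mul_sub, Finset.sum_add_distrib, Finset.sum_sub_distrib]
  ring

theorem CMI_zero {Ω : Type*} [Fintype Ω] {μ : Ω → ℝ} (hμ : IsProb μ)
    {α β γ : Type*} [Fintype α] [Fintype β] [Fintype γ]
    (X : Ω → α) (Y : Ω → β) (Z : Ω → γ) (h : CondIndep μ X Y Z) : CMI μ X Y Z = 0 := by
  rw [CMI_eq]
  refine Finset.sum_eq_zero fun ω _ => ?_
  rcases (hμ.1 ω).eq_or_lt with h0 | h0
  · simp [← h0]
  · have e := h (X ω) (Y ω) (Z ω)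
    have p1 := pr_pos hμ (fun ω => (X ω, Y ω, Z ω)) ω h0
    have p2 := pr_pos hμ Z ω h0
    have p3 := pr_pos hμ (fun ω => (X ω, Z ω)) ω h0
    have p4 := pr_pos hμ (fun ω => (Y ω, Z ω)) ω h0
    have e2 := congrArg (Real.logb 2) e
    rw [Real.logb_mul p1.ne' p2.ne', Real.logb_mul p3.ne' p4.ne'] at e2
    rw [e2]
    ring

theorem CMI_nonneg {Ω : Type*} [Fintype Ω] {μ : Ω → ℝ} (hμ : IsProb μ)
    {α β γ : Type*} [Fintype α] [Fintype β] [Fintype γ]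
    (X : Ω → α) (Y : Ω → β) (Z : Ω → γ) : 0 ≤ CMI μ X Y Z := by
  rw [CMI_eq]
  set A := pr μ (fun ω => (X ω, Y ω, Z ω)) with hA
  set B := pr μ Z with hB
  set C := pr μ (fun ω => (X ω, Z ω)) with hC
  set D := pr μ (fun ω => (Y ω, Z ω)) with hD
  have hl : 0 < Real.log 2 := Real.log_pos (by norm_num)
  have nB : ∀ c, 0 ≤ B c := pr_nonneg hμ Z
  have nC : ∀ c, 0 ≤ C c := pr_nonneg hμ _
  have nD : ∀ c, 0 ≤ D c := pr_nonneg hμ _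
  have nA : ∀ c, 0 ≤ A c := pr_nonneg hμ _
  let g : α × β × γ → ℝ := fun t => C (t.1, t.2.2) * D (t.2.1, t.2.2) / (A t * B t.2.2)
  have key : ∑ ω, μ ω * g (X ω, Y ω, Z ω) ≤ 1 := by
    rw [← sum_pr_mul μ (fun ω => (X ω, Y ω, Z ω)) g]
    calc ∑ t, A t * g t ≤ ∑ t : α × β × γ, C (t.1, t.2.2) * D (t.2.1, t.2.2) / B t.2.2 := by
          refine Finset.sum_le_sum fun t _ => ?_
          rcases (nA t).eq_or_lt with h0 | h0
          · rw [← h0, zero_mul]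
            exact div_nonneg (mul_nonneg (nC _) (nD _)) (nB _)
          · apply le_of_eq
            simp only [g]
            rw [← mul_div_assoc, mul_div_mul_left _ _ h0.ne']
      _ = ∑ c, (∑ a, C (a, c)) * (∑ b, D (b, c)) / B c := by
          simp only [Fintype.sum_prod_type, Finset.sum_mul_sum, Finset.sum_div]
          rw [Finset.sum_comm' (t' := Finset.univ) (s' := fun _ => Finset.univ) (by simp)]
          rw [Finset.sum_congr rfl fun b _ => Finset.sum_comm]
          rw [Finset.sum_comm]
          exact Finset.sum_congr rfl fun c _ => Finset.sum_comm
      _ = ∑ c, B c := by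
          refine Finset.sum_congr rfl fun c _ => ?_
          rw [pr_marg μ X Z c, pr_marg μ Y Z c]
          exact mul_self_div_self _
      _ = 1 := by
          have := sum_pr_mul μ Z (fun _ => 1)
          simp only [mul_one] at this
          rw [this, hμ.2]
      _ ≤ 1 := le_rfl
  have h2 : ∑ ω, μ ω * ((1 - g (X ω, Y ω, Z ω)) / Real.log 2) ≤
     ∑ ω, μ ω * (Real.logb 2 (A (X ω, Y ω, Z ω)) + Real.logb 2 (B (Z ω))
       - Real.logb 2 (C (X ω, Z ω)) - Real.logb 2 (D (Y ω, Z ω))) := by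
    refine Finset.sum_le_sum fun ω _ => ?_
    rcases (hμ.1 ω).eq_or_lt with h0 | h0
    · simp [← h0]
    · refine mul_le_mul_of_nonneg_left ?_ h0.le
      have p1 : 0 < A (X ω, Y ω, Z ω) := pr_pos hμ (fun ω => (X ω, Y ω, Z ω)) ω h0
      have p2 : 0 < B (Z ω) := pr_pos hμ Z ω h0
      have p3 : 0 < C (X ω, Z ω) := pr_pos hμ (fun ω => (X ω, Z ω)) ω h0
      have p4 : 0 < D (Y ω, Z ω) := pr_pos hμ (fun ω => (Y ω, Z ω)) ω h0
      have hg : 0 < g (X ω, Y ω, Z ω) := div_pos (mul_pos p3 p4) (mul_pos p1 p2)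
      have hlog := Real.log_le_sub_one_of_pos hg
      have e : Real.log (g (X ω, Y ω, Z ω)) = Real.log (C (X ω, Z ω)) + Real.log (D (Y ω, Z ω))
          - (Real.log (A (X ω, Y ω, Z ω)) + Real.log (B (Z ω))) := by
        simp only [g]
        rw [Real.log_div (mul_pos p3 p4).ne' (mul_pos p1 p2).ne', Real.log_mul p3.ne' p4.ne',
          Real.log_mul p1.ne' p2.ne']
      simp only [Real.logb, ← add_div, ← sub_div]
      apply div_le_div_of_nonneg_right _ hl.le
      linarith
  refine le_trans ?_ h2
  simp only [← mul_div_assoc, ← Finset.sum_div, mul_sub, mul_one, Finset.sum_sub_distrib, hμ.2]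
  exact div_nonneg (by linarith) hl.le

/-- Degraded broadcast channel bound: if
`Z_O ↔ Y_O ↔ X_O ↔ X_R ↔ Z_R ↔ Y_R` is a Markov chain, then with `X = (X_O, X_R)`,
`Y = (Y_O, Y_R)`, `Z = (Z_O, Z_R)` we have `I(X; Y | Z) ≤ I(X_O; Y_O | Z_O)`. -/
theorem degraded_channel_bound {Ω : Type*} [Fintype Ω] (μ : Ω → ℝ) (hμ : IsProb μ)
    {αXO αXR αYO αYR αZO αZR : Type*}
    [Fintype αXO] [Fintype αXR] [Fintype αYO] [Fintype αYR] [Fintype αZO] [Fintype αZR]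
    (XO : Ω → αXO) (XR : Ω → αXR) (YO : Ω → αYO) (YR : Ω → αYR)
    (ZO : Ω → αZO) (ZR : Ω → αZR)
    (h3 : CondIndep μ XO ZO YO)
    (h4 : CondIndep μ XR (fun ω => (ZO ω, YO ω)) XO)
    (h5 : CondIndep μ ZR (fun ω => (ZO ω, YO ω, XO ω)) XR)
    (h6 : CondIndep μ YR (fun ω => (ZO ω, YO ω, XO ω, XR ω)) ZR) :
    CMI μ (fun ω => (XO ω, XR ω)) (fun ω => (YO ω, YR ω)) (fun ω => (ZO ω, ZR ω)) ≤
      CMI μ XO YO ZO := by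
  have a6 := CMI_zero hμ _ _ _ h6
  have a5 := CMI_zero hμ _ _ _ h5
  have a4 := CMI_zero hμ _ _ _ h4
  have b1 := CMI_nonneg hμ ZR (fun ω => (XO ω, ZO ω)) XR
  have b2 := CMI_nonneg hμ XR ZO XO
  have b3 := CMI_nonneg hμ YR (fun ω => (YO ω, ZO ω)) ZR
  have b4 := CMI_nonneg hμ YO ZR ZO
  unfold CMI at *
  have c1 := H_congr μ (fun ω => (YR ω, (ZO ω, YO ω, XO ω, XR ω), ZR ω))
    (fun ω => ((XO ω, XR ω), (YO ω, YR ω), (ZO ω, ZR ω))) (by intros; simp only [Prod.mk.injEq]; tauto)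
  have c2 := H_congr μ (fun ω => ((ZO ω, YO ω, XO ω, XR ω), ZR ω))
    (fun ω => (ZR ω, (ZO ω, YO ω, XO ω), XR ω)) (by intros; simp only [Prod.mk.injEq]; tauto)
  have c3 := H_congr μ (fun ω => ((ZO ω, YO ω, XO ω), XR ω))
    (fun ω => (XR ω, (ZO ω, YO ω), XO ω)) (by intros; simp only [Prod.mk.injEq]; tauto)
  have c4 := H_congr μ (fun ω => ((ZO ω, YO ω), XO ω))
    (fun ω => (XO ω, YO ω, ZO ω)) (by intros; simp only [Prod.mk.injEq]; tauto)
  have c5 := H_congr μ (fun ω => ((XO ω, XR ω), (ZO ω, ZR ω)))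
    (fun ω => (ZR ω, (XO ω, ZO ω), XR ω)) (by intros; simp only [Prod.mk.injEq]; tauto)
  have c6 := H_congr μ (fun ω => ((XO ω, ZO ω), XR ω))
    (fun ω => (XR ω, ZO ω, XO ω)) (by intros; simp only [Prod.mk.injEq]; tauto)
  have c7 := H_congr μ (fun ω => (ZO ω, XO ω))
    (fun ω => (XO ω, ZO ω)) (by intros; simp only [Prod.mk.injEq]; tauto)
  have c8 := H_congr μ (fun ω => ((YO ω, YR ω), (ZO ω, ZR ω)))
    (fun ω => (YR ω, (YO ω, ZO ω), ZR ω)) (by intros; simp only [Prod.mk.injEq]; tauto)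
  have c9 := H_congr μ (fun ω => ((YO ω, ZO ω), ZR ω))
    (fun ω => (YO ω, ZR ω, ZO ω)) (by intros; simp only [Prod.mk.injEq]; tauto)
  have c10 := H_congr μ (fun ω => (ZR ω, ZO ω))
    (fun ω => (ZO ω, ZR ω)) (by intros; simp only [Prod.mk.injEq]; tauto)
  linarith
end
end
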